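/- Let B be a real Banach space that is strictly convex and smooth, with duality map j. Let Γ be a group generated by a finite symmetric subset K with a symmetric weight m on K, let π be a linear isometric action of Γ on B with no nonzero fixed vector, and let 1 < p < ∞. Then every affine isometric action of Γ on B with linear part π has a fixed point if and only if there exists a constant C > 0 such that every π-cocycle c : Γ → B satisfies ‖ Σ_{γ∈K} ‖c(γ)‖^{p−1} m(γ) j(c(γ)) ‖_{B*} ≥ C (Σ_{γ∈K} ‖c(γ)‖^p m(γ))^{(p−1)/p}. -/

import Mathlib

open Filter Topology

/-- A function on a complete metric space which is continuous and bounded below cannot strictly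
decrease from every point at a rate bounded below (Ekeland's principle, in Caristi's form). -/
theorem exists_forall_not_descent {X : Type*} [MetricSpace X] [CompleteSpace X] [Nonempty X]
    {g : X → ℝ} (hg : Continuous g) (hg0 : ∀ x, 0 ≤ g x) {C : ℝ} (hC : 0 < C) :
    ∃ x, ∀ y, g y + C * dist x y ≤ g x → g x ≤ g y := by
  by_contra! hdesc
  have hnext : ∀ x, ∃ y, g y + C * dist x y ≤ g x ∧
      ∀ z, g z + C * dist x z ≤ g x → 2 * g y ≤ g x + g z := by
    intro x
    set T := g '' {y | g y + C * dist x y ≤ g x}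
    have hT : BddBelow T := ⟨0, by rintro _ ⟨y, -, rfl⟩; exact hg0 y⟩
    obtain ⟨y, hy, hyx⟩ := hdesc x
    have hinf : sInf T < g x := (csInf_le hT ⟨y, hy, rfl⟩).trans_lt hyx
    obtain ⟨_, ⟨w, hw, rfl⟩, hlt⟩ := exists_lt_of_csInf_lt (⟨g y, y, hy, rfl⟩ : T.Nonempty)
      (show sInf T < (g x + sInf T) / 2 by linarith)
    refine ⟨w, hw, fun z hz ↦ ?_⟩
    have : sInf T ≤ g z := csInf_le hT ⟨z, hz, rfl⟩
    linarith
  choose f hf hfinf using hnext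
  obtain ⟨x₀⟩ := ‹Nonempty X›
  set u : ℕ → X := fun n ↦ f^[n] x₀
  have hu : ∀ n, u (n + 1) = f (u n) := fun n ↦ Function.iterate_succ_apply' f n x₀
  have hmono : ∀ n k, g (u (n + k)) + C * dist (u n) (u (n + k)) ≤ g (u n) := by
    intro n k
    induction k with
    | zero => simp
    | succ k ih =>
      have h₁ := hf (u (n + k))
      rw [← hu] at h₁
      have h₂ := mul_le_mul_of_nonneg_left
        (dist_triangle (u n) (u (n + k)) (u (n + k + 1))) hC.le
      rw [← add_assoc]
      linarith
  have hanti : Antitone (g ∘ u) := by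
    refine antitone_nat_of_succ_le fun n ↦ ?_
    have := hmono n 1
    have := mul_nonneg hC.le (dist_nonneg (x := u n) (y := u (n + 1)))
    simp only [Function.comp]
    linarith
  have hlim : Tendsto (g ∘ u) atTop (𝓝 (⨅ n, (g ∘ u) n)) :=
    tendsto_atTop_ciInf hanti ⟨0, by rintro _ ⟨n, rfl⟩; exact hg0 _⟩
  set L := ⨅ n, (g ∘ u) n
  have hL : ∀ n, L ≤ g (u n) := fun n ↦ hanti.le_of_tendsto hlim n
  have hcauchy : CauchySeq u := by
    refine cauchySeq_of_le_tendsto_0' (fun n ↦ (g (u n) - L) / C) (fun n k hnk ↦ ?_) ?_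
    · obtain ⟨k, rfl⟩ := Nat.exists_eq_add_of_le hnk
      rw [le_div_iff₀ hC]
      linarith [hmono n k, hL (n + k)]
    · simpa using (hlim.sub_const L).div_const C
  obtain ⟨x, hx⟩ := cauchySeq_tendsto_of_complete hcauchy
  have hgx : g x = L := tendsto_nhds_unique ((hg.tendsto x).comp hx) hlim
  have hxn : ∀ n, g x + C * dist (u n) x ≤ g (u n) := by
    intro n
    have hd : Tendsto (fun k ↦ g (u k) + C * dist (u n) (u k)) atTop
        (𝓝 (g x + C * dist (u n) x)) :=
      ((hg.tendsto x).comp hx).add ((tendsto_const_nhds.dist hx).const_mul C)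
    refine le_of_tendsto hd (eventually_atTop.2 ⟨n, fun k hk ↦ ?_⟩)
    obtain ⟨k, rfl⟩ := Nat.exists_eq_add_of_le hk
    exact hmono n k
  obtain ⟨y, hy, hyx⟩ := hdesc x
  have hyn : ∀ n, 2 * g (u (n + 1)) ≤ g (u n) + g y := by
    intro n
    rw [hu]
    refine hfinf _ _ ?_
    have := mul_le_mul_of_nonneg_left (dist_triangle (u n) x y) hC.le
    linarith [hxn n]
  have := le_of_tendsto_of_tendsto' (((tendsto_add_atTop_iff_nat 1).2 hlim).const_mul 2)
    (hlim.add_const (g y)) hyn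
  linarith

/-- The tangent line inequality for `x ↦ x ^ p` on the nonnegative reals. -/
theorem rpow_add_mul_sub_le_rpow {p a b : ℝ} (hp : 1 < p) (ha : 0 ≤ a) (hb : 0 ≤ b) :
    b ^ p + p * b ^ (p - 1) * (a - b) ≤ a ^ p := by
  rcases hb.eq_or_lt with rfl | hb
  · rw [Real.zero_rpow (by linarith), Real.zero_rpow (by linarith)]
    simpa using Real.rpow_nonneg ha p
  · have h := one_add_mul_self_le_rpow_one_add (s := a / b - 1) (p := p)
      (by linarith [div_nonneg ha hb.le]) hp.le
    rw [add_sub_cancel, Real.div_rpow ha hb.le, le_div_iff₀ (by positivity)] at h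
    calc b ^ p + p * b ^ (p - 1) * (a - b) = (1 + p * (a / b - 1)) * b ^ p := by
          rw [Real.rpow_sub_one hb.ne']; field_simp
      _ ≤ a ^ p := h

/-- `j` is the duality map of a smooth normed space. -/
structure IsDualityMap {B : Type*} [NormedAddCommGroup B] [NormedSpace ℝ B]
    (j : B → (B →L[ℝ] ℝ)) : Prop where
  map_zero : j 0 = 0
  norm_eq : ∀ v : B, v ≠ 0 → ‖j v‖ = 1
  apply_self_of_ne : ∀ v : B, v ≠ 0 → j v v = ‖v‖
  unique : ∀ v : B, v ≠ 0 → ∀ f : B →L[ℝ] ℝ, ‖f‖ = 1 → f v = ‖v‖ → f = j v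

namespace IsDualityMap

variable {B : Type*} [NormedAddCommGroup B] [NormedSpace ℝ B] {j : B → (B →L[ℝ] ℝ)}

theorem norm_le (hj : IsDualityMap j) (v : B) : ‖j v‖ ≤ 1 := by
  by_cases hv : v = 0
  · simp [hv, hj.map_zero]
  · exact (hj.norm_eq v hv).le

theorem abs_apply_le (hj : IsDualityMap j) (v w : B) : |j v w| ≤ ‖w‖ := by
  simpa using (j v).le_of_opNorm_le (hj.norm_le v) w

theorem apply_self (hj : IsDualityMap j) (v : B) : j v v = ‖v‖ := by
  by_cases hv : v = 0
  · simp [hv]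
  · exact hj.apply_self_of_ne v hv

theorem eq_of_norm_le (hj : IsDualityMap j) {v : B} (hv : v ≠ 0) {f : B →L[ℝ] ℝ}
    (hf : ‖f‖ ≤ 1) (hfv : f v = ‖v‖) : f = j v := by
  refine hj.unique v hv f (hf.antisymm ?_) hfv
  have h := f.le_opNorm v
  rw [hfv, norm_norm] at h
  exact (le_mul_iff_one_le_left (norm_pos_iff.2 hv)).1 h

theorem apply_neg (hj : IsDualityMap j) (v w : B) : j (-v) w = -j v w := by
  by_cases hv : v = 0
  · simp [hv, hj.map_zero]
  · rw [← hj.eq_of_norm_le (v := -v) (f := -j v) (by simpa using hv)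
      (by simpa using hj.norm_le v) (by simpa using hj.apply_self v)]
    simp

theorem apply_map (hj : IsDualityMap j) (u : B ≃ₗᵢ[ℝ] B) (v w : B) :
    j (u v) (u w) = j v w := by
  by_cases hv : v = 0
  · simp [hv, hj.map_zero]
  · rw [← hj.eq_of_norm_le (v := v)
      (f := (j (u v)).comp (u.toContinuousLinearEquiv : B →L[ℝ] B)) hv ?_ ?_]
    · rfl
    · refine ContinuousLinearMap.opNorm_le_bound _ zero_le_one fun x ↦ ?_
      simpa using hj.abs_apply_le (u v) (u x)
    · simpa using hj.apply_self (u v)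

theorem continuousAt_apply (hj : IsDualityMap j) {x : B} (hx : x ≠ 0) (w : B) :
    ContinuousAt (fun y ↦ j y w) x := by
  refine tendsto_iff_ultrafilter _ _ _ |>.2 fun U hU ↦ ?_
  have hmem : ((U.map fun y ↦ StrongDual.toWeakDual (j y) : Ultrafilter (WeakDual ℝ B)) :
      Filter (WeakDual ℝ B)) ≤
      𝓟 (WeakDual.toStrongDual ⁻¹' Metric.closedBall (0 : StrongDual ℝ B) 1) := by
    refine tendsto_principal.2 (Eventually.of_forall fun y ↦ ?_)
    have := hj.norm_le y
    simpa using this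
  obtain ⟨f, hf, hle⟩ := isCompact_iff_ultrafilter_le_nhds.1
    (WeakDual.isCompact_closedBall (𝕜 := ℝ) (0 : StrongDual ℝ B) 1) _ hmem
  have hlim : ∀ z, Tendsto (fun y ↦ j y z) U (𝓝 (f z)) := fun z ↦
    ((WeakDual.eval_continuous z).tendsto f).comp
      (show Tendsto (fun y ↦ StrongDual.toWeakDual (j y)) U (𝓝 f) from hle)
  have hid : Tendsto (fun y : B ↦ y) U (𝓝 x) := hU
  have hfx : f x = ‖x‖ := by
    refine tendsto_nhds_unique (hlim x) ?_
    have hsmall : Tendsto (fun y ↦ j y (x - y)) U (𝓝 0) := by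
      refine squeeze_zero_norm (fun y ↦ hj.abs_apply_le y (x - y)) ?_
      simpa using (tendsto_const_nhds (x := x)).sub hid |>.norm
    have := hid.norm.add hsmall
    rw [add_zero] at this
    refine this.congr fun y ↦ ?_
    rw [← hj.apply_self y, ← (j y).map_add, add_sub_cancel]
  have hfj : WeakDual.toStrongDual f = j x :=
    hj.eq_of_norm_le hx (by simpa using hf) hfx
  have := hlim w
  rw [show f w = j x w from DFunLike.congr_fun hfj w] at this
  exact this

theorem continuous_rpow_mul_apply (hj : IsDualityMap j) {p : ℝ} (hp : 1 < p) (w : B) :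
    Continuous fun y ↦ ‖y‖ ^ (p - 1) * j y w := by
  have hpow : Continuous fun y : B ↦ ‖y‖ ^ (p - 1) :=
    continuous_norm.rpow_const fun _ ↦ Or.inr (by linarith)
  refine continuous_iff_continuousAt.2 fun x ↦ ?_
  by_cases hx : x = 0
  · subst hx
    have h0 : Tendsto (fun y : B ↦ ‖y‖ ^ (p - 1) * ‖w‖) (𝓝 0) (𝓝 0) := by
      have := (hpow.mul_const ‖w‖).tendsto 0
      simpa [Real.zero_rpow (show p - 1 ≠ 0 by linarith)] using this
    rw [ContinuousAt, hj.map_zero]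
    simp only [zero_apply, mul_zero]
    refine squeeze_zero_norm (fun y ↦ ?_) h0
    rw [norm_mul, Real.norm_of_nonneg (by positivity)]
    exact mul_le_mul_of_nonneg_left (hj.abs_apply_le y w) (by positivity)
  · exact hpow.continuousAt.mul (hj.continuousAt_apply hx w)

/-- The subgradient inequality for `x ↦ ‖x‖ ^ p`. -/
theorem rpow_norm_le (hj : IsDualityMap j) {p : ℝ} (hp : 1 < p) (x y : B) :
    ‖y‖ ^ p ≤ ‖x‖ ^ p + p * (‖y‖ ^ (p - 1) * j y (y - x)) := by
  have h₁ := rpow_add_mul_sub_le_rpow hp (norm_nonneg x) (norm_nonneg y)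
  have h₂ : ‖y‖ - ‖x‖ ≤ j y (y - x) := by
    rw [map_sub, hj.apply_self]
    linarith [(le_abs_self _).trans (hj.abs_apply_le y x)]
  have h₃ := mul_le_mul_of_nonneg_left h₂
    (show 0 ≤ p * ‖y‖ ^ (p - 1) by positivity)
  linarith

end IsDualityMap

section Cocycle

variable {B : Type*} [NormedAddCommGroup B] [NormedSpace ℝ B] {Γ : Type*} [Group Γ]

/-- `c` is a cocycle for the linear isometric action `π`. -/
def IsCocycle (π : Γ →* (B ≃ₗᵢ[ℝ] B)) (c : Γ → B) : Prop :=
  ∀ γ γ' : Γ, c (γ * γ') = π γ (c γ') + c γ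

variable {π : Γ →* (B ≃ₗᵢ[ℝ] B)} {c : Γ → B}

theorem isCocycle_coboundary (v : B) : IsCocycle π fun γ ↦ v - π γ v := by
  intro γ γ'
  simp

namespace IsCocycle

theorem map_one (hc : IsCocycle π c) : c 1 = 0 := by
  simpa using hc 1 1

theorem map_inv (hc : IsCocycle π c) (γ : Γ) : c γ⁻¹ = -π γ⁻¹ (c γ) := by
  have := hc γ⁻¹ γ
  rw [inv_mul_cancel, hc.map_one] at this
  exact eq_neg_of_add_eq_zero_right this.symm

theorem norm_map_inv (hc : IsCocycle π c) (γ : Γ) : ‖c γ⁻¹‖ = ‖c γ‖ := by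
  rw [hc.map_inv, norm_neg, LinearIsometryEquiv.norm_map]

theorem sub {d : Γ → B} (hc : IsCocycle π c) (hd : IsCocycle π d) :
    IsCocycle π fun γ ↦ c γ - d γ := by
  intro γ γ'
  simp only [hc γ γ', hd γ γ', map_sub]
  abel

theorem eq_zero_of_forall_mem {K : Set Γ} (hK : Subgroup.closure K = ⊤) (hc : IsCocycle π c)
    (h : ∀ γ ∈ K, c γ = 0) (γ : Γ) : c γ = 0 := by
  have hγ : γ ∈ Subgroup.closure K := hK ▸ Subgroup.mem_top γ
  induction hγ using Subgroup.closure_induction with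
  | mem x hx => exact h x hx
  | one => exact hc.map_one
  | mul x y _ _ hx hy => simp [hc x y, hx, hy]
  | inv x _ hx => simp [hc.map_inv, hx]

end IsCocycle

/-- If the coboundaries of `u n` converge on a generating set, they converge to a cocycle. -/
theorem exists_isCocycle_tendsto {K : Set Γ} (hK : Subgroup.closure K = ⊤) (u : ℕ → B)
    (h : ∀ γ ∈ K, ∃ b, Tendsto (fun n ↦ u n - π γ (u n)) atTop (𝓝 b)) :
    ∃ c, IsCocycle π c ∧ ∀ γ, Tendsto (fun n ↦ u n - π γ (u n)) atTop (𝓝 (c γ)) := by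
  have hall : ∀ γ, ∃ b, Tendsto (fun n ↦ u n - π γ (u n)) atTop (𝓝 b) := by
    intro γ
    have hγ : γ ∈ Subgroup.closure K := hK ▸ Subgroup.mem_top γ
    induction hγ using Subgroup.closure_induction with
    | mem x hx => exact h x hx
    | one => exact ⟨0, by simp⟩
    | mul x y _ _ hx hy =>
      obtain ⟨a, ha⟩ := hx
      obtain ⟨b, hb⟩ := hy
      refine ⟨π x b + a, ((((π x).continuous.tendsto b).comp hb).add ha).congr fun n ↦ ?_⟩
      simp
    | inv x _ hx =>
      obtain ⟨a, ha⟩ := hx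
      refine ⟨-π x⁻¹ a, (((π x⁻¹).continuous.tendsto a).comp ha).neg.congr fun n ↦ ?_⟩
      exact ((isCocycle_coboundary (π := π) (u n)).map_inv x).symm
  choose c hc using hall
  refine ⟨c, fun γ γ' ↦ tendsto_nhds_unique (hc (γ * γ')) ?_, hc⟩
  refine ((((π γ).continuous.tendsto _).comp (hc γ')).add (hc γ)).congr fun n ↦ ?_
  simp

/-- If every cocycle is a coboundary and there are no invariant vectors, then the coboundary map
is bounded below on a finite generating set. -/
theorem exists_norm_le_of_forall_isCocycle [CompleteSpace B] {K : Finset Γ}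
    (hK : Subgroup.closure (K : Set Γ) = ⊤) (hπ : ∀ v : B, (∀ γ : Γ, π γ v = v) → v = 0)
    (h : ∀ c, IsCocycle π c → ∃ v : B, ∀ γ, c γ = v - π γ v) :
    ∃ A : ℝ, 0 ≤ A ∧ ∀ (v : B) (r : ℝ), 0 ≤ r → (∀ γ ∈ K, ‖v - π γ v‖ ≤ r) → ‖v‖ ≤ A * r := by
  let δ : B →L[ℝ] (K → B) := ContinuousLinearMap.pi fun γ ↦
    ContinuousLinearMap.id ℝ B - ((π γ).toContinuousLinearEquiv : B →L[ℝ] B)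
  have hδ : ∀ v γ, δ v γ = v - π γ v := fun v γ ↦ rfl
  have hinj : Function.Injective δ := by
    refine (injective_iff_map_eq_zero δ).2 fun v hv ↦ hπ v fun γ ↦ ?_
    have := (isCocycle_coboundary (π := π) v).eq_zero_of_forall_mem hK
      (fun γ hγ ↦ congr_fun hv ⟨γ, hγ⟩) γ
    exact (sub_eq_zero.1 this).symm
  have hclosed : IsClosed (Set.range δ) := by
    refine isClosed_of_closure_subset fun x hx ↦ ?_
    obtain ⟨y, hy, hyx⟩ := mem_closure_iff_seq_limit.1 hx
    choose u hu using hy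
    have hux : ∀ γ : K, Tendsto (fun n ↦ u n - π γ (u n)) atTop (𝓝 (x γ)) := fun γ ↦ by
      refine (tendsto_pi_nhds.1 hyx γ).congr fun n ↦ ?_
      rw [← hu, hδ]
    obtain ⟨c, hc, hcu⟩ := exists_isCocycle_tendsto hK u fun γ hγ ↦ ⟨_, hux ⟨γ, hγ⟩⟩
    obtain ⟨v, hv⟩ := h c hc
    refine ⟨v, funext fun γ ↦ ?_⟩
    rw [hδ, ← hv]
    exact tendsto_nhds_unique (hcu γ) (hux γ)
  obtain ⟨A, hA⟩ := δ.antilipschitz_of_injective_of_isClosed_range hinj hclosed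
  refine ⟨A, A.2, fun v r hr hv ↦ ?_⟩
  have h₁ : ‖v‖ ≤ A * ‖δ v‖ := by simpa using hA.le_mul_dist v 0
  exact h₁.trans (mul_le_mul_of_nonneg_left
    ((pi_norm_le_iff_of_nonneg hr).2 fun γ ↦ hv γ γ.2) A.2)

theorem sum_rpow_smul_apply {ι : Type*} (K : Finset ι) (m : ι → ℝ) (c : ι → B)
    (j : B → (B →L[ℝ] ℝ)) (p : ℝ) (w : B) :
    (∑ γ ∈ K, (‖c γ‖ ^ (p - 1) * m γ) • j (c γ)) w =
      ∑ γ ∈ K, m γ * (‖c γ‖ ^ (p - 1) * j (c γ) w) := by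
  rw [sum_apply]
  refine Finset.sum_congr rfl fun γ _ ↦ ?_
  rw [smul_apply, smul_eq_mul]
  ring

/-- Symmetrization of the gradient functional of a cocycle. -/
theorem IsCocycle.two_mul_sum_smul_apply {j : B → (B →L[ℝ] ℝ)} (hj : IsDualityMap j)
    {K : Finset Γ} (hKsym : ∀ γ ∈ K, γ⁻¹ ∈ K) {m : Γ → ℝ} (hmsym : ∀ γ ∈ K, m γ = m γ⁻¹)
    (p : ℝ) (hc : IsCocycle π c) (w : B) :
    2 * (∑ γ ∈ K, (‖c γ‖ ^ (p - 1) * m γ) • j (c γ)) w =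
      ∑ γ ∈ K, m γ * (‖c γ‖ ^ (p - 1) * j (c γ) (w - π γ w)) := by
  have hinv : ∑ γ ∈ K, m γ * (‖c γ‖ ^ (p - 1) * j (c γ) w) =
      ∑ γ ∈ K, -(m γ * (‖c γ‖ ^ (p - 1) * j (c γ) (π γ w))) := by
    refine Finset.sum_nbij' (fun γ ↦ γ⁻¹) (fun γ ↦ γ⁻¹) hKsym hKsym (by simp) (by simp)
      fun γ hγ ↦ ?_
    rw [← hmsym γ hγ, hc.norm_map_inv, hc.map_inv, hj.apply_neg, hj.apply_map]
    ring
  rw [sum_rpow_smul_apply, two_mul]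
  nth_rewrite 2 [hinv]
  rw [← Finset.sum_add_distrib]
  refine Finset.sum_congr rfl fun γ _ ↦ ?_
  rw [map_sub]
  ring

/-- A lower bound for the gradient functional of the `p`-energy forces every cocycle to be a
coboundary. -/
theorem IsCocycle.exists_eq_coboundary [CompleteSpace B] {j : B → (B →L[ℝ] ℝ)}
    (hj : IsDualityMap j) {K : Finset Γ} (hKsym : ∀ γ ∈ K, γ⁻¹ ∈ K)
    (hK : Subgroup.closure (K : Set Γ) = ⊤) {m : Γ → ℝ} (hmpos : ∀ γ ∈ K, 0 < m γ)
    (hmsym : ∀ γ ∈ K, m γ = m γ⁻¹) {p : ℝ} (hp : 1 < p) {C : ℝ} (hC : 0 < C)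
    (hgrad : ∀ c, IsCocycle π c → C * (∑ γ ∈ K, ‖c γ‖ ^ p * m γ) ^ ((p - 1) / p) ≤
      ‖∑ γ ∈ K, (‖c γ‖ ^ (p - 1) * m γ) • j (c γ)‖)
    (hc : IsCocycle π c) : ∃ v : B, ∀ γ, c γ = v - π γ v := by
  have hp0 : 0 < p := by linarith
  let d : B → Γ → B := fun v γ ↦ c γ - (v - π γ v)
  have hd : ∀ v, IsCocycle π (d v) := fun v ↦ hc.sub (isCocycle_coboundary v)
  have hdcont : ∀ γ, Continuous fun v ↦ d v γ := fun γ ↦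
    continuous_const.sub (continuous_id.sub (π γ).continuous)
  let E : B → ℝ := fun v ↦ ∑ γ ∈ K, ‖d v γ‖ ^ p * m γ
  have hterm : ∀ v, ∀ γ ∈ K, 0 ≤ ‖d v γ‖ ^ p * m γ := fun v γ hγ ↦
    mul_nonneg (by positivity) (hmpos γ hγ).le
  have hE : ∀ v, 0 ≤ E v := fun v ↦ Finset.sum_nonneg (hterm v)
  have hEcont : Continuous E := continuous_finsetSum _ fun γ _ ↦
    ((hdcont γ).norm.rpow_const fun _ ↦ Or.inr hp0.le).mul_const _
  obtain ⟨v, hv⟩ := exists_forall_not_descent (g := fun v ↦ E v ^ (1 / p))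
    (hEcont.rpow_const fun _ ↦ Or.inr (by positivity)) (fun v ↦ Real.rpow_nonneg (hE v) _) hC
  rcases (hE v).eq_or_lt with hEv | hEv
  · refine ⟨v, fun γ ↦ sub_eq_zero.1 ((hd v).eq_zero_of_forall_mem hK (fun γ hγ ↦ ?_) γ)⟩
    have h₀ := (Finset.sum_eq_zero_iff_of_nonneg (hterm v)).1 hEv.symm γ hγ
    rw [mul_eq_zero, or_iff_left (hmpos γ hγ).ne', Real.rpow_eq_zero (norm_nonneg _) hp0.ne'] at h₀
    exact norm_eq_zero.1 h₀
  exfalso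
  set a := E v ^ (1 / p) with ha
  have hapos : 0 < a := Real.rpow_pos_of_pos hEv _
  have hap : a ^ p = E v := by
    rw [ha, ← Real.rpow_mul hEv.le, one_div_mul_cancel hp0.ne', Real.rpow_one]
  have hap1 : a ^ (p - 1) = E v ^ ((p - 1) / p) := by
    rw [ha, ← Real.rpow_mul hEv.le]
    congr 1
    ring
  have hap1pos : 0 < a ^ (p - 1) := Real.rpow_pos_of_pos hapos _
  let F : B → (B →L[ℝ] ℝ) := fun v ↦ ∑ γ ∈ K, (‖d v γ‖ ^ (p - 1) * m γ) • j (d v γ)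
  have hFv : C * a ^ (p - 1) ≤ ‖F v‖ := by
    rw [hap1]
    exact hgrad _ (hd v)
  obtain ⟨w, hw⟩ : ∃ w, C / 2 * a ^ (p - 1) * ‖w‖ < F v w := by
    by_contra! hcon
    have : ‖F v‖ ≤ C / 2 * a ^ (p - 1) := by
      refine ContinuousLinearMap.opNorm_le_bound _ (by positivity) fun w ↦ abs_le.2 ⟨?_, hcon w⟩
      have := hcon (-w)
      rw [map_neg, norm_neg] at this
      linarith
    have := mul_pos hC hap1pos
    linarith
  have hwpos : 0 < ‖w‖ := by
    refine norm_pos_iff.2 fun h0 ↦ ?_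
    simp [h0] at hw
  have hline : Tendsto (fun t : ℝ ↦ v + t • w) (𝓝[>] 0) (𝓝 v) := by
    have : Continuous fun t : ℝ ↦ v + t • w := by fun_prop
    simpa using (this.tendsto 0).mono_left nhdsWithin_le_nhds
  have hFcont : Continuous fun x ↦ F x w := by
    simp only [F, sum_rpow_smul_apply]
    exact continuous_finsetSum _ fun γ _ ↦
      ((hj.continuous_rpow_mul_apply hp w).comp (hdcont γ)).const_mul _
  have hev₁ : ∀ᶠ t : ℝ in 𝓝[>] 0, C / 2 * a ^ (p - 1) * ‖w‖ < F (v + t • w) w :=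
    ((hFcont.tendsto v).comp hline).eventually (lt_mem_nhds hw)
  have hev₂ : ∀ᶠ t : ℝ in 𝓝[>] 0, C * (t * ‖w‖) < a := by
    have : Continuous fun t : ℝ ↦ C * (t * ‖w‖) := by fun_prop
    refine ((this.tendsto 0).mono_left nhdsWithin_le_nhds).eventually (gt_mem_nhds ?_)
    simpa using hapos
  obtain ⟨t, ht₁, ht₂, ht⟩ := (hev₁.and (hev₂.and self_mem_nhdsWithin)).exists
  have ht : 0 < t := ht
  set y := v + t • w with hy
  have hdy : ∀ γ, d y γ - d v γ = -(t • (w - π γ w)) := fun γ ↦ by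
    simp only [d, hy, map_add, map_smul, smul_sub]
    abel
  have hEy : E y ≤ E v - t * p * (2 * F y w) := by
    rw [(hd y).two_mul_sum_smul_apply hj hKsym hmsym p w, Finset.mul_sum,
      ← Finset.sum_sub_distrib]
    refine Finset.sum_le_sum fun γ hγ ↦ ?_
    have h₁ := mul_le_mul_of_nonneg_right (hj.rpow_norm_le hp (d v γ) (d y γ)) (hmpos γ hγ).le
    rw [hdy, map_neg, map_smul, smul_eq_mul] at h₁
    linarith
  have hEy' : E y ≤ (a - C * (t * ‖w‖)) ^ p := by
    have h₁ := rpow_add_mul_sub_le_rpow hp (sub_nonneg.2 ht₂.le) hapos.le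
    have h₂ := mul_le_mul_of_nonneg_left ht₁.le (show 0 ≤ t * p * 2 by positivity)
    rw [hap] at h₁
    linarith
  have hgy : E y ^ (1 / p) ≤ a - C * (t * ‖w‖) := by
    rw [one_div]
    exact (Real.rpow_inv_le_iff_of_pos (hE y) (sub_nonneg.2 ht₂.le) hp0).2 hEy'
  have hdist : dist v y = t * ‖w‖ := by
    rw [hy, dist_self_add_right, norm_smul, Real.norm_of_nonneg ht.le]
  have hle := hv y (by rw [hdist]; linarith)
  have := mul_pos hC (mul_pos ht hwpos)
  linarith

/-- If every cocycle is a coboundary and there are no invariant vectors, then the gradient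
functional of the `p`-energy is bounded below. -/
theorem exists_gradient_lower_bound [CompleteSpace B] {j : B → (B →L[ℝ] ℝ)}
    (hj : IsDualityMap j) {K : Finset Γ} (hKsym : ∀ γ ∈ K, γ⁻¹ ∈ K)
    (hK : Subgroup.closure (K : Set Γ) = ⊤) {m : Γ → ℝ} (hmpos : ∀ γ ∈ K, 0 < m γ)
    (hmsym : ∀ γ ∈ K, m γ = m γ⁻¹) {p : ℝ} (hp : 1 < p)
    (hπ : ∀ v : B, (∀ γ : Γ, π γ v = v) → v = 0)
    (h : ∀ c, IsCocycle π c → ∃ v : B, ∀ γ, c γ = v - π γ v) :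
    ∃ C > (0 : ℝ), ∀ c, IsCocycle π c →
      C * (∑ γ ∈ K, ‖c γ‖ ^ p * m γ) ^ ((p - 1) / p) ≤
        ‖∑ γ ∈ K, (‖c γ‖ ^ (p - 1) * m γ) • j (c γ)‖ := by
  have hp0 : 0 < p := by linarith
  obtain ⟨A, hA, hbound⟩ := exists_norm_le_of_forall_isCocycle hK hπ h
  set M : ℝ := ∑ γ ∈ K, (m γ)⁻¹ ^ (1 / p)
  have hMterm : ∀ γ ∈ K, 0 ≤ (m γ)⁻¹ ^ (1 / p) := fun γ hγ ↦
    Real.rpow_nonneg (inv_nonneg.2 (hmpos γ hγ).le) _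
  have hM : 0 ≤ M := Finset.sum_nonneg hMterm
  refine ⟨(2 * (A * M) + 1)⁻¹, by positivity, fun c hc ↦ ?_⟩
  obtain ⟨v, hv⟩ := h c hc
  set E := ∑ γ ∈ K, ‖c γ‖ ^ p * m γ with hEdef
  set F := ∑ γ ∈ K, (‖c γ‖ ^ (p - 1) * m γ) • j (c γ)
  have hterm : ∀ γ ∈ K, 0 ≤ ‖c γ‖ ^ p * m γ := fun γ hγ ↦
    mul_nonneg (by positivity) (hmpos γ hγ).le
  have hE : 0 ≤ E := Finset.sum_nonneg hterm
  rw [inv_mul_le_iff₀ (by positivity)]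
  rcases hE.eq_or_lt with hE0 | hEpos
  · rw [← hE0, Real.zero_rpow (div_pos (by linarith) hp0).ne']
    positivity
  have hnorm : ‖v‖ ≤ A * (M * E ^ (1 / p)) := by
    refine hbound v _ (by positivity) fun γ hγ ↦ ?_
    rw [← hv]
    have h₁ : ‖c γ‖ ^ p ≤ (m γ)⁻¹ * E := by
      rw [le_inv_mul_iff₀ (hmpos γ hγ), mul_comm]
      exact Finset.single_le_sum hterm hγ
    calc ‖c γ‖ = (‖c γ‖ ^ p) ^ (1 / p) := by
          rw [one_div, Real.rpow_rpow_inv (norm_nonneg _) hp0.ne']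
      _ ≤ ((m γ)⁻¹ * E) ^ (1 / p) := Real.rpow_le_rpow (by positivity) h₁ (by positivity)
      _ = (m γ)⁻¹ ^ (1 / p) * E ^ (1 / p) :=
          Real.mul_rpow (inv_nonneg.2 (hmpos γ hγ).le) hE
      _ ≤ M * E ^ (1 / p) :=
          mul_le_mul_of_nonneg_right (Finset.single_le_sum hMterm hγ) (by positivity)
  have henergy : 2 * F v = E := by
    rw [hc.two_mul_sum_smul_apply hj hKsym hmsym p v]
    refine Finset.sum_congr rfl fun γ _ ↦ ?_
    rw [← hv, hj.apply_self]
    by_cases h0 : ‖c γ‖ = 0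
    · simp [h0, Real.zero_rpow hp0.ne']
    · rw [Real.rpow_sub_one h0]
      field_simp
  have hsplit : E ^ ((p - 1) / p) * E ^ (1 / p) = E := by
    rw [← Real.rpow_add hEpos, ← add_div, sub_add_cancel, div_self hp0.ne', Real.rpow_one]
  have hFv : F v ≤ ‖F‖ * (A * (M * E ^ (1 / p))) :=
    (le_abs_self _).trans ((F.le_opNorm v).trans (mul_le_mul_of_nonneg_left hnorm (norm_nonneg F)))
  have hroot : 0 < E ^ (1 / p) := Real.rpow_pos_of_pos hEpos _
  have hfin : E ^ ((p - 1) / p) ≤ 2 * (A * M) * ‖F‖ := by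
    refine le_of_mul_le_mul_right ?_ hroot
    rw [hsplit]
    linarith
  linarith [norm_nonneg F]

end Cocycle

/-- Affine isometric actions of `Γ` on `B` with linear part `π` correspond exactly to
`π`-cocycles `c : Γ → B` via `α(γ)v = π(γ)v + c(γ)`; such an action has a fixed point
iff there is `v` with `π(γ)v + c(γ) = v` for all `γ`. -/
theorem stmt18 {B : Type*} [NormedAddCommGroup B] [NormedSpace ℝ B] [CompleteSpace B]
    -- `B` is strictly convex:
    (hB : ∀ v u : B, v ≠ u → ‖v‖ ≤ 1 → ‖u‖ ≤ 1 → ‖v + u‖ < 2)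
    -- `B` is smooth, with duality map `j`:
    (j : B → (B →L[ℝ] ℝ)) (hj0 : j 0 = 0)
    (hjn : ∀ v : B, v ≠ 0 → ‖j v‖ = 1)
    (hjv : ∀ v : B, v ≠ 0 → j v v = ‖v‖)
    (hjuniq : ∀ v : B, v ≠ 0 → ∀ f : B →L[ℝ] ℝ, ‖f‖ = 1 → f v = ‖v‖ → f = j v)
    {Γ : Type*} [Group Γ] (K : Finset Γ)
    (hKsym : ∀ γ ∈ K, γ⁻¹ ∈ K)
    (hKgen : Subgroup.closure (K : Set Γ) = ⊤)
    -- `m` is a symmetric weight on `K`: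
    (m : Γ → ℝ) (hmpos : ∀ γ ∈ K, 0 < m γ) (hmsym : ∀ γ ∈ K, m γ = m γ⁻¹)
    (hmsum : ∑ γ ∈ K, m γ = 1)
    -- `π` is a linear isometric action with no nonzero fixed vector:
    (π : Γ →* (B ≃ₗᵢ[ℝ] B)) (hπ : ∀ v : B, (∀ γ : Γ, π γ v = v) → v = 0)
    (p : ℝ) (hp : 1 < p) :
    (∀ c : Γ → B, (∀ γ γ' : Γ, c (γ * γ') = π γ (c γ') + c γ) →
        ∃ v : B, ∀ γ : Γ, π γ v + c γ = v) ↔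
      (∃ C > (0 : ℝ), ∀ c : Γ → B, (∀ γ γ' : Γ, c (γ * γ') = π γ (c γ') + c γ) →
        C * (∑ γ ∈ K, ‖c γ‖ ^ p * m γ) ^ ((p - 1) / p) ≤
          ‖∑ γ ∈ K, (‖c γ‖ ^ (p - 1) * m γ) • j (c γ)‖) := by
  have hj : IsDualityMap j := ⟨hj0, hjn, hjv, hjuniq⟩
  have hfix : ∀ (c : Γ → B) (v : B),
      (∀ γ : Γ, π γ v + c γ = v) ↔ ∀ γ, c γ = v - π γ v := fun c v ↦
    forall_congr' fun γ ↦ by rw [eq_sub_iff_add_eq, add_comm]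
  simp only [hfix]
  exact ⟨exists_gradient_lower_bound hj hKsym hKgen hmpos hmsym hp hπ,
    fun ⟨C, hC, hgrad⟩ c hc ↦ IsCocycle.exists_eq_coboundary hj hKsym hKgen hmpos hmsym hp hC
      hgrad hc⟩
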